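/- Moving averages, spectral tail process: Let α > 0, let C = (C_i)_{i∈ℤ^d} be a random element of l₀ with c := Σ_{k∈ℤ^d} E[|C_k|^α] ∈ (0,∞), and let κ be a {−1,1}-valued random variable independent of C. Let Θ = (Θ_i)_{i∈ℤ^d} be a random element of l₀ whose distribution satisfies E[h(Θ)] = c^{−1} E[Σ_{k∈ℤ^d} h(κ·θ_k C/|C_k|) |C_k|^α] for all measurable h : l₀ → [0,∞) (summands with C_k = 0 are zero). Then |Θ_0| = 1 almost surely and Θ satisfies the time-change formula with index α, i.e. E[h(|Θ_k|^{−1} θ_k Θ) 1{Θ_k ≠ 0}] = E[h(Θ) |Θ_{−k}|^α] for every measurable h : l₀ → [0,∞) and every k ∈ ℤ^d; equivalently, if V is Pareto(α)-distributed and independent of Θ, then V·Θ is exceedance-stationary. -/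

import Mathlib

open MeasureTheory ENNReal Filter ProbabilityTheory

noncomputable section

/-- The space `ℝ^{ℤ^d}` of real-valued fields indexed by `ℤ^d`. -/
abbrev RField (d : ℕ) := (Fin d → ℤ) → ℝ

variable {d : ℕ}

/-- Shift operator: `shift k x = (x_{i+k})_i`, i.e. it moves the origin to `k`. -/
def shift (k : Fin d → ℤ) (x : RField d) : RField d := fun i => x (i + k)

/-- The set of exceedance-points of `x`. -/
def excSet (x : RField d) : Set (Fin d → ℤ) := {k | 1 < |x k|}

open Classical in
/-- Indicator (with values in `ℝ≥0∞`) of the event that `|x k| > s`. -/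
def exIndGT (s : ℝ) (k : Fin d → ℤ) (x : RField d) : ℝ≥0∞ := if s < |x k| then 1 else 0

/-- The tail-process identity:
`E[h(θ_k Y) 1{|Y_k| > 1}] = E[h(Y) 1{|Y_{−k}| > 1}]` for every measurable nonnegative `h`
and every `k ∈ ℤ^d`. -/
def TailIdentity {Ω : Type*} [MeasurableSpace Ω] (μ : Measure Ω) (Y : Ω → RField d) : Prop :=
  ∀ h : RField d → ℝ≥0∞, Measurable h → ∀ k : Fin d → ℤ,
    ∫⁻ ω, h (shift k (Y ω)) * exIndGT 1 k (Y ω) ∂μ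
      = ∫⁻ ω, h (Y ω) * exIndGT 1 (-k) (Y ω) ∂μ

/-- `Y` is exceedance-stationary: for every exceedance-map `τ` which is bijective on a
measurable set `B` (invariant under shifting the origin to exceedance-points, contained in
`ℝ₀^{ℤ^d}`) carrying the law of `Y`, we have `θ_τ Y ≐ Y`. -/
def ExcStationary {Ω : Type*} [MeasurableSpace Ω] (μ : Measure Ω) (Y : Ω → RField d) : Prop :=
  ∀ (B : Set (RField d)) (τ : RField d → Fin d → ℤ),
    MeasurableSet B → Measurable τ →
    (∀ x ∈ B, 1 < |x 0|) →
    (∀ x ∈ B, ∀ k ∈ excSet x, shift k x ∈ B) →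
    (∀ x ∈ B, τ x ∈ excSet x) →
    (∀ x ∈ B, Set.BijOn (fun k => k + τ (shift k x)) (excSet x) (excSet x)) →
    (∀ᵐ ω ∂μ, Y ω ∈ B) →
    Measure.map (fun ω => shift (τ (Y ω)) (Y ω)) μ = Measure.map Y μ

/-- `E₀`: elements of `ℝ₀^{ℤ^d}` with finitely many exceedance-points. -/
def E0set (d : ℕ) : Set (RField d) := {x | 1 < |x 0| ∧ (excSet x).Finite}

/-- `E`: elements of `ℝ^{ℤ^d}` with at least one but finitely many exceedance-points. -/
def Eset (d : ℕ) : Set (RField d) := {x | (excSet x).Nonempty ∧ (excSet x).Finite}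

/-- `l₀`: fields vanishing at infinity. -/
def l0set (d : ℕ) : Set (RField d) := {x | Tendsto (fun i => |x i|) cofinite (nhds 0)}

/-- Uniform norm `‖x‖ = sup_i |x_i|`. -/
def supNorm (x : RField d) : ℝ := ⨆ i, |x i|

/-- `V` is Pareto(α)-distributed: `P(V > y) = y^{-α}` for `y ≥ 1`. -/
def IsPareto {Ω : Type*} [MeasurableSpace Ω] (μ : Measure Ω) (V : Ω → ℝ) (α : ℝ) : Prop :=
  ∀ y : ℝ, 1 ≤ y → μ {ω | y < V ω} = ENNReal.ofReal (y ^ (-α))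

/-- An anchoring function on `S`: a measurable shift-covariant exceedance-map. -/
def IsAnchoringOn (S : Set (RField d)) (A : RField d → Fin d → ℤ) : Prop :=
  Measurable A ∧ ∀ x ∈ S, A x ∈ excSet x ∧ ∀ k ∈ excSet x, A (shift k x) + k = A x

/-- `h` is shift-invariant on `S`. -/
def ShiftInvariantOn (S : Set (RField d)) (h : RField d → ℝ≥0∞) : Prop :=
  ∀ x ∈ S, ∀ k : Fin d → ℤ, h (shift k x) = h x

open Classical in
/-- The time-change formula with index `α`:
`E[h(|Θ_k|⁻¹ θ_k Θ) 1{Θ_k ≠ 0}] = E[h(Θ) |Θ_{−k}|^α]` for all measurable `h ≥ 0`, `k ∈ ℤ^d`. -/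
def TimeChange {d : ℕ} {Ω : Type*} [MeasurableSpace Ω] (μ : Measure Ω)
    (Θ : Ω → RField d) (α : ℝ) : Prop :=
  ∀ h : RField d → ℝ≥0∞, Measurable h → ∀ k : Fin d → ℤ,
    ∫⁻ ω, (if Θ ω k = 0 then 0 else h (|Θ ω k|⁻¹ • shift k (Θ ω))) ∂μ
      = ∫⁻ ω, h (Θ ω) * ENNReal.ofReal (|Θ ω (-k)| ^ α) ∂μ

theorem measurable_shift (k : Fin d → ℤ) : Measurable (shift k : RField d → RField d) :=
  measurable_pi_lambda _ fun i => measurable_pi_apply (i + k)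

theorem measurable_shift_of_measurable {τ : RField d → Fin d → ℤ} (hτ : Measurable τ) :
    Measurable fun x : RField d => shift (τ x) x := by
  have key : Measurable fun p : (Fin d → ℤ) × RField d => shift p.1 p.2 :=
    measurable_from_prod_countable_right fun k => measurable_shift k
  exact key.comp (hτ.prodMk measurable_id)

theorem measurable_exIndGT (s : ℝ) (k : Fin d → ℤ) :
    Measurable (exIndGT s k : RField d → ℝ≥0∞) := by
  classical
  unfold exIndGT
  exact Measurable.ite (measurableSet_lt measurable_const (by fun_prop)) measurable_const
    measurable_const

/-- The measure on `(0, ∞)` with tails `u ↦ u ^ (-α)`. -/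
def powerTailMeasure (α : ℝ) : Measure ℝ :=
  (volume.restrict (Set.Ioi 0)).withDensity fun u => ENNReal.ofReal (α * u ^ (-α - 1))

instance (α : ℝ) : SFinite (powerTailMeasure α) := by
  unfold powerTailMeasure; infer_instance

theorem ae_pos_powerTailMeasure (α : ℝ) : ∀ᵐ u ∂powerTailMeasure α, 0 < u :=
  (withDensity_absolutelyContinuous _ _).ae_le (ae_restrict_mem measurableSet_Ioi)

theorem powerTailMeasure_Ioi {α : ℝ} (hα : 0 < α) {y : ℝ} (hy : 0 < y) :
    powerTailMeasure α (Set.Ioi y) = ENNReal.ofReal (y ^ (-α)) := by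
  unfold powerTailMeasure
  rw [withDensity_apply _ measurableSet_Ioi, Measure.restrict_restrict measurableSet_Ioi,
    Set.inter_eq_left.2 (Set.Ioi_subset_Ioi hy.le), ← ofReal_integral_eq_lintegral_ofReal,
    integral_const_mul, integral_Ioi_rpow_of_lt (by linarith) hy]
  · congr 1
    rw [show -α - 1 + 1 = -α by ring]
    field_simp
  · exact (integrableOn_Ioi_rpow_of_lt (by linarith) hy).const_mul α
  · refine (ae_restrict_mem measurableSet_Ioi).mono fun u hu => ?_
    have : 0 < u := hy.trans hu
    simp only [Pi.zero_apply]
    positivity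

/-- Rescaling a Pareto law by `a⁻¹` yields, up to the factor `a ^ α`, the restriction of the
power-tail measure to `(a⁻¹, ∞)`. -/
theorem pareto_map_mul_inv {α : ℝ} (hα : 0 < α) (P : Measure ℝ) [IsProbabilityMeasure P]
    (hP : ∀ y : ℝ, 1 ≤ y → P (Set.Ioi y) = ENNReal.ofReal (y ^ (-α))) {a : ℝ} (ha : 0 < a) :
    ENNReal.ofReal (a ^ α) • P.map (fun v => v * a⁻¹)
      = (powerTailMeasure α).restrict (Set.Ioi a⁻¹) := by
  have hmeas : Measurable fun v : ℝ => v * a⁻¹ := by fun_prop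
  have : IsProbabilityMeasure (P.map fun v => v * a⁻¹) :=
    Measure.isProbabilityMeasure_map hmeas.aemeasurable
  have hP_small : ∀ y : ℝ, y ≤ 1 → P (Set.Ioi y) = 1 := fun y hy =>
    le_antisymm prob_le_one <| by
      calc (1 : ℝ≥0∞) = P (Set.Ioi 1) := by simp [hP 1 le_rfl]
        _ ≤ _ := measure_mono (Set.Ioi_subset_Ioi hy)
  have : IsFiniteMeasure (ENNReal.ofReal (a ^ α) • P.map fun v => v * a⁻¹) :=
    Measure.smul_finite _ ENNReal.ofReal_ne_top
  have hIoi : ∀ y : ℝ, (ENNReal.ofReal (a ^ α) • P.map (fun v => v * a⁻¹)) (Set.Ioi y)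
      = (powerTailMeasure α).restrict (Set.Ioi a⁻¹) (Set.Ioi y) := by
    intro y
    have hpre : (fun v : ℝ => v * a⁻¹) ⁻¹' Set.Ioi y = Set.Ioi (y * a) := by
      ext v
      simp only [Set.mem_preimage, Set.mem_Ioi, ← div_eq_mul_inv, lt_div_iff₀ ha]
    rw [Measure.smul_apply, Measure.map_apply hmeas measurableSet_Ioi, hpre,
      Measure.restrict_apply measurableSet_Ioi, Set.Ioi_inter_Ioi, smul_eq_mul]
    rcases le_total y a⁻¹ with h | h
    · have h1 : y * a ≤ 1 := by rwa [← le_div_iff₀ ha, one_div]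
      rw [sup_eq_right.2 h, hP_small _ h1, powerTailMeasure_Ioi hα (inv_pos.2 ha), mul_one,
        Real.inv_rpow ha.le, Real.rpow_neg ha.le, inv_inv]
    · have h1 : 1 ≤ y * a := by rwa [← div_le_iff₀ ha, one_div]
      have hy : 0 < y := (inv_pos.2 ha).trans_le h
      rw [sup_eq_left.2 h, hP _ h1, powerTailMeasure_Ioi hα hy,
        ← ENNReal.ofReal_mul (by positivity), Real.mul_rpow hy.le ha.le, Real.rpow_neg ha.le]
      congr 1
      have : a ^ α ≠ 0 := (Real.rpow_pos_of_pos ha α).ne'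
      field_simp
  refine ext_of_generate_finite _ ((BorelSpace.measurable_eq (α := ℝ)).trans
    (borel_eq_generateFrom_Ioi ℝ)) isPiSystem_Ioi ?_ ?_
  · rintro _ ⟨y, rfl⟩
    exact hIoi y
  · rw [Measure.smul_apply, measure_univ, Measure.restrict_apply_univ,
      powerTailMeasure_Ioi hα (inv_pos.2 ha), smul_eq_mul, mul_one, Real.inv_rpow ha.le,
      Real.rpow_neg ha.le, inv_inv]

theorem lintegral_pareto_mul_inv {α : ℝ} (hα : 0 < α) (P : Measure ℝ) [IsProbabilityMeasure P]
    (hP : ∀ y : ℝ, 1 ≤ y → P (Set.Ioi y) = ENNReal.ofReal (y ^ (-α))) {a : ℝ} (ha : 0 < a)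
    {f : ℝ → ℝ≥0∞} (hf : Measurable f) :
    ENNReal.ofReal (a ^ α) * ∫⁻ v, f (v * a⁻¹) ∂P
      = ∫⁻ u in Set.Ioi a⁻¹, f u ∂powerTailMeasure α := by
  rw [← pareto_map_mul_inv hα P hP ha, lintegral_smul_measure, lintegral_map hf (by fun_prop),
    smul_eq_mul]

/-- The tail-process identity implies exceedance-stationarity. -/
theorem TailIdentity.excStationary {Ω : Type*} [MeasurableSpace Ω] {μ : Measure Ω}
    {Y : Ω → RField d} (hY : Measurable Y) (hT : TailIdentity μ Y) : ExcStationary μ Y := by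
  classical
  intro B τ _ hτ hB0 _ hτe hbij hYB
  refine Measure.ext fun A hA => ?_
  have hτY : Measurable fun ω => shift (τ (Y ω)) (Y ω) :=
    (measurable_shift_of_measurable hτ).comp hY
  set g : (Fin d → ℤ) → RField d → ℝ≥0∞ := fun k x =>
    A.indicator 1 x * (if τ (shift (-k) x) = k then 1 else 0) with hg
  have hgm : ∀ k, Measurable (g k) := fun k =>
    (measurable_one.indicator hA).mul
      (Measurable.ite ((hτ.comp (measurable_shift (-k))) (measurableSet_singleton k))
        measurable_const measurable_const)
  have hss : ∀ (k : Fin d → ℤ) (x : RField d), shift (-k) (shift k x) = x := fun k x => by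
    ext i; simp [shift]
  have h1 : ∀ᵐ ω ∂μ, A.indicator (1 : RField d → ℝ≥0∞) (shift (τ (Y ω)) (Y ω))
      = ∑' k, g k (shift k (Y ω)) * exIndGT 1 k (Y ω) := by
    filter_upwards [hYB] with ω hω
    rw [tsum_eq_single (τ (Y ω))]
    · have : 1 < |Y ω (τ (Y ω))| := hτe _ hω
      simp [hg, hss, exIndGT, this]
    · intro k hk
      simp [hg, hss, hk.symm]
  have h2 : ∀ᵐ ω ∂μ, ∑' k, g k (Y ω) * exIndGT 1 (-k) (Y ω)
      = A.indicator (1 : RField d → ℝ≥0∞) (Y ω) := by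
    filter_upwards [hYB] with ω hω
    obtain ⟨j, hj, hj0⟩ := (hbij _ hω).surjOn (show (0 : Fin d → ℤ) ∈ excSet (Y ω) from hB0 _ hω)
    have hj' : 1 < |Y ω j| := hj
    simp only at hj0
    rw [tsum_eq_single (-j)]
    · have : τ (shift j (Y ω)) = -j := (neg_eq_of_add_eq_zero_right hj0).symm
      simp [hg, exIndGT, hj', this]
    · intro k hk
      by_cases hke : 1 < |Y ω (-k)|
      · have : τ (shift (-k) (Y ω)) ≠ k := fun h => hk <| by
          rw [← (hbij _ hω).injOn (show -k ∈ excSet (Y ω) from hke) hj (by simp [h, hj0]), neg_neg]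
        simp [hg, this]
      · simp [exIndGT, hke]
  calc Measure.map (fun ω => shift (τ (Y ω)) (Y ω)) μ A
      = ∫⁻ ω, A.indicator 1 (shift (τ (Y ω)) (Y ω)) ∂μ := by
        rw [← lintegral_indicator_one hA, lintegral_map (measurable_one.indicator hA) hτY]
    _ = ∑' k, ∫⁻ ω, g k (shift k (Y ω)) * exIndGT 1 k (Y ω) ∂μ := by
        rw [lintegral_congr_ae h1, lintegral_tsum fun k => ?_]
        exact (((hgm k).comp ((measurable_shift k).comp hY)).mul
          ((measurable_exIndGT 1 k).comp hY)).aemeasurable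
    _ = ∑' k, ∫⁻ ω, g k (Y ω) * exIndGT 1 (-k) (Y ω) ∂μ := by
        simp_rw [hT _ (hgm _) _]
    _ = ∫⁻ ω, A.indicator 1 (Y ω) ∂μ := by
        rw [← lintegral_congr_ae h2, lintegral_tsum fun k => ?_]
        exact (((hgm k).comp hY).mul ((measurable_exIndGT 1 (-k)).comp hY)).aemeasurable
    _ = Measure.map Y μ A := by
        rw [← lintegral_indicator_one hA, lintegral_map (measurable_one.indicator hA) hY]

open Classical in
/-- The law of `V • Θ` for `V` Pareto(α) and independent of the spectral tail process `Θ` of a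
moving average with coefficients `C` and signs `κ`. -/
theorem lintegral_pareto_smul_spectral
    {Ω : Type*} [MeasurableSpace Ω] {μ : Measure Ω}
    {Ω₂ : Type*} [MeasurableSpace Ω₂] {μ₂ : Measure Ω₂} [IsProbabilityMeasure μ₂]
    {α : ℝ} (hα : 0 < α) {C : Ω → RField d} {c : ℝ≥0∞} {κ : Ω → ℝ}
    {Θ : Ω₂ → RField d} (hΘ : Measurable Θ)
    (hlaw : ∀ h : RField d → ℝ≥0∞, Measurable h →
      ∫⁻ ω, h (Θ ω) ∂μ₂
        = c⁻¹ * ∫⁻ ω, ∑' k : Fin d → ℤ,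
            (if C ω k = 0 then 0
              else ENNReal.ofReal (|C ω k| ^ α) *
                h (κ ω • |C ω k|⁻¹ • shift k (C ω))) ∂μ)
    {V : Ω₂ → ℝ} (hV : Measurable V) (hVP : IsPareto μ₂ V α) (hVΘ : IndepFun V Θ μ₂)
    {G : RField d → ℝ≥0∞} (hG : Measurable G) :
    ∫⁻ ω, G (V ω • Θ ω) ∂μ₂
      = c⁻¹ * ∫⁻ ω, ∫⁻ u, ∑' k : Fin d → ℤ,
          (if 1 < u * |C ω k| then G (u • κ ω • shift k (C ω)) else 0)
            ∂powerTailMeasure α ∂μ := by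
  have : IsProbabilityMeasure (μ₂.map V) := Measure.isProbabilityMeasure_map hV.aemeasurable
  have hPI : ∀ y : ℝ, 1 ≤ y → μ₂.map V (Set.Ioi y) = ENNReal.ofReal (y ^ (-α)) := fun y hy => by
    rw [Measure.map_apply hV measurableSet_Ioi]
    exact hVP y hy
  have hGs : Measurable fun p : ℝ × RField d => G (p.1 • p.2) :=
    hG.comp (measurable_fst.smul measurable_snd)
  have hH : Measurable fun x : RField d => ∫⁻ v, G (v • x) ∂μ₂.map V := hGs.lintegral_prod_left'
  calc ∫⁻ ω, G (V ω • Θ ω) ∂μ₂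
      = ∫⁻ p, G (p.1 • p.2) ∂μ₂.map fun ω => (V ω, Θ ω) := by
        rw [lintegral_map hGs (hV.prodMk hΘ)]
    _ = ∫⁻ ω, ∫⁻ v, G (v • Θ ω) ∂μ₂.map V ∂μ₂ := by
        rw [(indepFun_iff_map_prod_eq_prod_map_map hV.aemeasurable hΘ.aemeasurable).1 hVΘ,
          lintegral_prod_symm _ hGs.aemeasurable, lintegral_map hH hΘ]
    _ = _ := by
        rw [hlaw _ hH]
        congr 1
        refine lintegral_congr fun ω => ?_
        have hf : ∀ k, Measurable fun u : ℝ => G (u • κ ω • shift k (C ω)) := fun k =>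
          hGs.comp (measurable_id.prodMk measurable_const)
        have hset : ∀ k, MeasurableSet {u : ℝ | 1 < u * |C ω k|} := fun k =>
          measurableSet_lt measurable_const (by fun_prop)
        rw [lintegral_tsum fun k =>
          (Measurable.ite (hset k) (hf k) measurable_const).aemeasurable]
        refine tsum_congr fun k => ?_
        by_cases hk : C ω k = 0
        · simp [hk, not_lt.2 (zero_le_one' ℝ)]
        · have hpos : 0 < |C ω k| := abs_pos.2 hk
          have hIoi : {u : ℝ | 1 < u * |C ω k|} = Set.Ioi |C ω k|⁻¹ := by
            ext u
            rw [Set.mem_ofPred_eq, Set.mem_Ioi, ← div_lt_iff₀ hpos, one_div]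
          rw [if_neg hk]
          calc _ = ENNReal.ofReal (|C ω k| ^ α) *
                ∫⁻ v, G ((v * |C ω k|⁻¹) • κ ω • shift k (C ω)) ∂μ₂.map V := by
                simp_rw [mul_smul, smul_comm (κ ω)]
            _ = _ := by
                rw [lintegral_pareto_mul_inv hα _ hPI hpos (hf k), ← hIoi,
                  ← lintegral_indicator (hset k)]
                rfl

open Classical in
/-- **moving averages: spectral tail process.** Let `C ∈ l₀` with
`c = Σ_k E[|C_k|^α] ∈ (0,∞)` and `κ ∈ {−1,1}` independent of `C`. If `Θ` is a random
element of `l₀` whose law satisfies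
`E[h(Θ)] = c⁻¹ E[Σ_k h(κ θ_k C/|C_k|) |C_k|^α]` for all measurable `h ≥ 0`, then
`|Θ_0| = 1` a.s. and `Θ` satisfies the time-change formula with index `α`; equivalently,
for every Pareto(α)-distributed `V` independent of `Θ`, `V·Θ` is exceedance-stationary. -/
theorem moving_average_spectral_tail
    {Ω : Type*} [MeasurableSpace Ω] (μ : Measure Ω) [IsProbabilityMeasure μ]
    {Ω₂ : Type*} [MeasurableSpace Ω₂] (μ₂ : Measure Ω₂) [IsProbabilityMeasure μ₂]
    (α : ℝ) (hα : 0 < α)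
    (C : Ω → RField d) (hC : Measurable C) (hCl0 : ∀ᵐ ω ∂μ, C ω ∈ l0set d)
    (c : ℝ≥0∞) (hcdef : c = ∑' k : Fin d → ℤ, ∫⁻ ω, ENNReal.ofReal (|C ω k| ^ α) ∂μ)
    (hc0 : 0 < c) (hcT : c ≠ ⊤)
    (κ : Ω → ℝ) (hκ : Measurable κ) (hκval : ∀ᵐ ω ∂μ, κ ω = 1 ∨ κ ω = -1)
    (hκind : IndepFun κ C μ)
    (Θ : Ω₂ → RField d) (hΘ : Measurable Θ) (hΘl0 : ∀ᵐ ω ∂μ₂, Θ ω ∈ l0set d)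
    (hlaw : ∀ h : RField d → ℝ≥0∞, Measurable h →
      ∫⁻ ω, h (Θ ω) ∂μ₂
        = c⁻¹ * ∫⁻ ω, ∑' k : Fin d → ℤ,
            (if C ω k = 0 then 0
              else ENNReal.ofReal (|C ω k| ^ α) *
                h (κ ω • |C ω k|⁻¹ • shift k (C ω))) ∂μ) :
    (∀ᵐ ω ∂μ₂, |Θ ω 0| = 1) ∧
    TimeChange μ₂ Θ α ∧
    (∀ V : Ω₂ → ℝ, Measurable V → IsPareto μ₂ V α → IndepFun V Θ μ₂ →
      ExcStationary μ₂ (fun ω => V ω • Θ ω)) := by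
  have hκabs : ∀ᵐ ω ∂μ, |κ ω| = 1 := hκval.mono fun ω h => by
    rcases h with h | h <;> simp [h]
  refine ⟨?_, ?_, ?_⟩
  · have hs : MeasurableSet {x : RField d | |x 0| ≠ 1} :=
      (measurableSet_eq_fun (by fun_prop) measurable_const).compl
    have h0 := hlaw _ (measurable_one.indicator hs)
    rw [lintegral_congr_ae (μ := μ) (g := fun _ => 0), lintegral_zero, mul_zero,
      ← lintegral_map (measurable_one.indicator hs) hΘ, lintegral_indicator_one hs,
      Measure.map_apply hΘ hs] at h0
    · exact h0
    · filter_upwards [hκabs] with ω hω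
      refine ENNReal.tsum_eq_zero.2 fun k => ?_
      by_cases hk : C ω k = 0
      · simp [hk]
      · simp [hk, shift, abs_mul, hω]
  · intro h hh k
    have hm1 : Measurable fun x : RField d => if x k = 0 then 0 else h (|x k|⁻¹ • shift k x) :=
      Measurable.ite (measurableSet_eq_fun (measurable_pi_apply k) measurable_const)
        measurable_const
        (hh.comp (Measurable.smul (f := fun x : RField d => |x k|⁻¹) (by fun_prop) (measurable_shift k)))
    have hm2 : Measurable fun x : RField d => h x * ENNReal.ofReal (|x (-k)| ^ α) :=
      hh.mul (by fun_prop)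
    rw [hlaw _ hm1, hlaw _ hm2]
    congr 1
    refine lintegral_congr_ae ?_
    filter_upwards [hκabs] with ω hω
    have hκ0 : κ ω ≠ 0 := fun h0 => by simp [h0] at hω
    refine Eq.trans ?_ ((Equiv.addRight k).tsum_eq _)
    refine tsum_congr fun j => ?_
    have hm : Equiv.addRight k j = j + k := rfl
    generalize Equiv.addRight k j = m at hm ⊢
    subst hm
    have hzero : (0 : ℝ) ^ α = 0 := Real.zero_rpow hα.ne'
    by_cases hj : C ω j = 0
    · by_cases hjk : C ω (j + k) = 0 <;> simp [hj, hjk, shift, hzero, show -k + (j + k) = j by abel]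
    by_cases hjk : C ω (j + k) = 0
    · simp [hj, hjk, shift, add_comm k j]
    have hj' : 0 < |C ω j| := abs_pos.2 hj
    have hjk' : 0 < |C ω (j + k)| := abs_pos.2 hjk
    have hval : (κ ω • |C ω j|⁻¹ • shift j (C ω)) k = κ ω * (|C ω j|⁻¹ * C ω (j + k)) := by
      simp [shift, add_comm k j]
    have hval' : (κ ω • |C ω (j + k)|⁻¹ • shift (j + k) (C ω)) (-k)
        = κ ω * (|C ω (j + k)|⁻¹ * C ω j) := by
      simp [shift, show -k + (j + k) = j by abel]
    have harg : |κ ω * (|C ω j|⁻¹ * C ω (j + k))|⁻¹ •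
        shift k (κ ω • |C ω j|⁻¹ • shift j (C ω))
          = κ ω • |C ω (j + k)|⁻¹ • shift (j + k) (C ω) := by
      ext i
      simp only [abs_mul, hω, abs_inv, abs_abs, shift, Pi.smul_apply, smul_eq_mul,
        show i + k + j = i + (j + k) by abel]
      field_simp
    rw [if_neg hj, if_neg hjk, hval, hval', harg,
      if_neg (mul_ne_zero hκ0 (mul_ne_zero (inv_ne_zero hj'.ne') hjk)), mul_comm (h _),
      ← mul_assoc, ← ENNReal.ofReal_mul (by positivity)]
    congr 2
    rw [← Real.mul_rpow (by positivity) (by positivity)]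
    congr 1
    simp only [abs_mul, hω, abs_inv, abs_abs]
    field_simp
  · intro V hV hVP hVΘ
    refine TailIdentity.excStationary (hV.smul hΘ) fun h hh k => ?_
    have hm1 : Measurable fun x : RField d => h (shift k x) * exIndGT 1 k x :=
      (hh.comp (measurable_shift k)).mul (measurable_exIndGT 1 k)
    have hm2 : Measurable fun x : RField d => h x * exIndGT 1 (-k) x :=
      hh.mul (measurable_exIndGT 1 (-k))
    rw [lintegral_pareto_smul_spectral hα hΘ hlaw hV hVP hVΘ hm1,
      lintegral_pareto_smul_spectral hα hΘ hlaw hV hVP hVΘ hm2]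
    congr 1
    refine lintegral_congr_ae ?_
    filter_upwards [hκabs] with ω hω
    refine lintegral_congr_ae ?_
    filter_upwards [ae_pos_powerTailMeasure α] with u hu
    refine Eq.trans ?_ ((Equiv.addRight k).tsum_eq _)
    refine tsum_congr fun j => ?_
    have hm : Equiv.addRight k j = j + k := rfl
    generalize Equiv.addRight k j = m at hm ⊢
    subst hm
    have hsh : shift k (u • κ ω • shift j (C ω)) = u • κ ω • shift (j + k) (C ω) := by
      ext i
      simp [shift, show i + k + j = i + (j + k) by abel]
    have hx1 : exIndGT 1 k (u • κ ω • shift j (C ω))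
        = if 1 < u * |C ω (j + k)| then 1 else 0 := by
      simp [exIndGT, shift, abs_mul, hω, abs_of_pos hu, add_comm k j]
    have hx2 : exIndGT 1 (-k) (u • κ ω • shift (j + k) (C ω))
        = if 1 < u * |C ω j| then 1 else 0 := by
      simp [exIndGT, shift, abs_mul, hω, abs_of_pos hu, show -k + (j + k) = j by abel]
    rw [hsh, hx1, hx2]
    split_ifs <;> simp
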